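/- (Positivity of the symmetric second-order coefficient.) Define g(ε) = (1/√π)·(1 − Q(√2·Q⁻¹(ε))) + (ε − 2)·φ(Q⁻¹(ε)) for ε ∈ (0,1). Then g(ε) > 0 for all ε ∈ (0, 0.1968]. (This is the claim that, when C1 = C2 and V1 = V2, the square-root term in the converse expansion of log M*_sf(l, ε) is strictly negative for all ε ≤ 0.1968.) -/

import Mathlib

open MeasureTheory Real

noncomputable section

/-- The standard normal density `φ(x) = e^{−x²/2}/√(2π)`. -/
def stdGaussianPDF (x : ℝ) : ℝ := Real.exp (-x ^ 2 / 2) / Real.sqrt (2 * Real.pi)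

/-- The standard Gaussian tail function `Q(x) = ∫_x^∞ φ(t) dt`. -/
def gaussQ (x : ℝ) : ℝ := ∫ t in Set.Ioi x, stdGaussianPDF t

theorem continuous_stdGaussianPDF : Continuous stdGaussianPDF := by
  unfold stdGaussianPDF
  fun_prop

theorem stdGaussianPDF_pos (x : ℝ) : 0 < stdGaussianPDF x := by
  unfold stdGaussianPDF
  positivity

theorem integrable_stdGaussianPDF : Integrable stdGaussianPDF := by
  have h := (integrable_exp_neg_mul_sq (b := 1 / 2) (by norm_num)).div_const (√(2 * π))
  refine h.congr (Filter.Eventually.of_forall fun x => ?_)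
  simp only [stdGaussianPDF]
  ring_nf

theorem gaussQ_zero : gaussQ 0 = 1 / 2 := by
  have h := integral_gaussian_Ioi (1 / 2)
  have hs : √(π / (1 / 2)) = √(2 * π) := by congr 1; ring
  rw [hs] at h
  have h2 : gaussQ 0 = (∫ t in Set.Ioi (0 : ℝ), Real.exp (-(1 / 2) * t ^ 2)) / √(2 * π) := by
    rw [← integral_div]
    simp only [gaussQ, stdGaussianPDF]
    congr 1 with t
    ring_nf
  have hpos : √(2 * π) ≠ 0 := by positivity
  rw [h2, h]
  field_simp

theorem gaussQ_eq (x : ℝ) : gaussQ x = 1 / 2 - ∫ t in (0 : ℝ)..x, stdGaussianPDF t := by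
  have h := intervalIntegral.integral_interval_add_Ioi
    (integrable_stdGaussianPDF.integrableOn (s := Set.Ioi 0))
    (integrable_stdGaussianPDF.integrableOn (s := Set.Ioi x))
  have h0 := gaussQ_zero
  unfold gaussQ at h0 ⊢
  linarith

theorem gaussQ_antitone : Antitone gaussQ := fun _ _ hxy =>
  setIntegral_mono_set integrable_stdGaussianPDF.integrableOn
    (Filter.Eventually.of_forall fun x => (stdGaussianPDF_pos x).le)
    (Set.Ioi_subset_Ioi hxy).eventuallyLE

theorem gaussQ_le_one {x : ℝ} (hx : 0 ≤ x) : gaussQ x ≤ 1 := by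
  have := gaussQ_antitone hx
  rw [gaussQ_zero] at this
  linarith

theorem hasDerivAt_gaussQ (x : ℝ) : HasDerivAt gaussQ (-stdGaussianPDF x) x := by
  rw [funext gaussQ_eq]
  exact (continuous_stdGaussianPDF.integral_hasStrictDerivAt 0 x).hasDerivAt.const_sub _

theorem hasDerivAt_stdGaussianPDF (x : ℝ) :
    HasDerivAt stdGaussianPDF (-x * stdGaussianPDF x) x := by
  have h : HasDerivAt (fun x : ℝ => -x ^ 2 / 2) (-x) x := by
    have := ((hasDerivAt_pow 2 x).neg).div_const 2
    refine this.congr_deriv ?_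
    push_cast
    ring
  refine (h.exp.div_const (√(2 * π))).congr_deriv ?_
  simp only [stdGaussianPDF]
  ring

/-- The symmetric second-order coefficient as a function of `y = Q⁻¹(ε)`. -/
def symmetricCoefficient (y : ℝ) : ℝ :=
  (1 / √π) * (1 - gaussQ (√2 * y)) + (gaussQ y - 2) * stdGaussianPDF y

theorem stdGaussianPDF_sqrt_two_mul (y : ℝ) :
    (1 / √π) * (stdGaussianPDF (√2 * y) * √2) = 2 * stdGaussianPDF y ^ 2 := by
  have h2 : √2 ≠ 0 := by positivity
  have hp : √π ≠ 0 := by positivity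
  have hsq : √2 ^ 2 = 2 := Real.sq_sqrt (by norm_num)
  unfold stdGaussianPDF
  rw [Real.sqrt_mul (by norm_num), div_pow, ← Real.exp_nat_mul, mul_pow, mul_pow, hsq]
  have : ((2 : ℕ) : ℝ) * (-y ^ 2 / 2) = -(2 * y ^ 2) / 2 := by push_cast; ring
  rw [this]
  field_simp

theorem hasDerivAt_symmetricCoefficient (y : ℝ) :
    HasDerivAt symmetricCoefficient
      (stdGaussianPDF y ^ 2 + (2 - gaussQ y) * (y * stdGaussianPDF y)) y := by
  have hQ : HasDerivAt (fun y => gaussQ (√2 * y)) (-stdGaussianPDF (√2 * y) * √2) y :=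
    (hasDerivAt_gaussQ (√2 * y)).comp y (by simpa using (hasDerivAt_id y).const_mul (√2))
  have h := ((hQ.const_sub 1).const_mul (1 / √π)).add
    (((hasDerivAt_gaussQ y).sub_const 2).mul (hasDerivAt_stdGaussianPDF y))
  refine h.congr_deriv ?_
  linear_combination stdGaussianPDF_sqrt_two_mul y

theorem symmetricCoefficient_monotoneOn : MonotoneOn symmetricCoefficient (Set.Ici 0) := by
  refine monotoneOn_of_hasDerivWithinAt_nonneg (convex_Ici 0)
    (fun y _ => (hasDerivAt_symmetricCoefficient y).continuousAt.continuousWithinAt)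
    (fun y _ => (hasDerivAt_symmetricCoefficient y).hasDerivWithinAt) fun y hy => ?_
  rw [interior_Ici, Set.mem_Ioi] at hy
  have h1 := gaussQ_le_one hy.le
  have h2 : 0 ≤ 2 - gaussQ y := by linarith
  have := stdGaussianPDF_pos y
  positivity

theorem abs_exp_neg_sub_taylor_le {u : ℝ} (h0 : 0 ≤ u) (h1 : u ≤ 1) :
    |Real.exp (-u) - (1 - u + u ^ 2 / 2 - u ^ 3 / 6 + u ^ 4 / 24 - u ^ 5 / 120 + u ^ 6 / 720
      - u ^ 7 / 5040)| ≤ u ^ 8 / 35840 := by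
  have h := Real.exp_bound (x := -u) (by rwa [abs_neg, abs_of_nonneg h0]) (n := 8) (by norm_num)
  rw [abs_neg, abs_of_nonneg h0] at h
  simp only [Finset.sum_range_succ, Finset.sum_range_zero, Nat.factorial] at h
  norm_num at h
  convert h using 1
  · congr 1
    ring
  · ring

/-- The degree-15 antiderivative of the Taylor polynomial of `exp (-c * x ^ 2)`. -/
def gaussTaylorIntegral (c x : ℝ) : ℝ :=
  x - c * x ^ 3 / 3 + c ^ 2 * x ^ 5 / 10 - c ^ 3 * x ^ 7 / 42 + c ^ 4 * x ^ 9 / 216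
    - c ^ 5 * x ^ 11 / 1320 + c ^ 6 * x ^ 13 / 9360 - c ^ 7 * x ^ 15 / 75600

theorem abs_integral_exp_neg_mul_sq_sub_le {c a : ℝ} (hc : 0 ≤ c) (ha : 0 ≤ a)
    (h : c * a ^ 2 ≤ 1) :
    |(∫ t in (0 : ℝ)..a, Real.exp (-(c * t ^ 2))) - gaussTaylorIntegral c a|
      ≤ c ^ 8 * a ^ 17 / 609280 := by
  have hT : ∀ t : ℝ, HasDerivAt (gaussTaylorIntegral c)
      (1 - c * t ^ 2 + (c * t ^ 2) ^ 2 / 2 - (c * t ^ 2) ^ 3 / 6 + (c * t ^ 2) ^ 4 / 24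
        - (c * t ^ 2) ^ 5 / 120 + (c * t ^ 2) ^ 6 / 720 - (c * t ^ 2) ^ 7 / 5040) t := by
    intro t
    have hm : ∀ (k : ℕ) (b d : ℝ),
        HasDerivAt (fun x : ℝ => b * x ^ k / d) (b * (k * t ^ (k - 1)) / d) t :=
      fun k b d => ((hasDerivAt_pow k t).const_mul b).div_const d
    have hsum := ((((((((hasDerivAt_id t).sub (hm 3 c 3)).add (hm 5 (c ^ 2) 10)).sub
      (hm 7 (c ^ 3) 42)).add (hm 9 (c ^ 4) 216)).sub (hm 11 (c ^ 5) 1320)).add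
      (hm 13 (c ^ 6) 9360)).sub (hm 15 (c ^ 7) 75600))
    refine hsum.congr_deriv ?_
    norm_num
    ring
  have hi : ∀ f : ℝ → ℝ, Continuous f → IntervalIntegrable f volume 0 a :=
    fun f hf => hf.intervalIntegrable 0 a
  have hint := intervalIntegral.integral_eq_sub_of_hasDerivAt (a := 0) (b := a)
    (fun t _ => hT t) (hi _ (by fun_prop))
  have h0 : gaussTaylorIntegral c 0 = 0 := by simp [gaussTaylorIntegral]
  rw [h0, sub_zero] at hint
  have hR : ∫ t in (0 : ℝ)..a, (c * t ^ 2) ^ 8 / 35840 = c ^ 8 * a ^ 17 / 609280 := by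
    have : ∀ t : ℝ, (c * t ^ 2) ^ 8 / 35840 = c ^ 8 / 35840 * t ^ 16 := fun t => by ring
    simp_rw [this, intervalIntegral.integral_const_mul, integral_pow]
    norm_num
    ring
  rw [← hint, ← intervalIntegral.integral_sub (hi _ (by fun_prop)) (hi _ (by fun_prop)), ← hR,
    ← Real.norm_eq_abs]
  refine intervalIntegral.norm_integral_le_of_norm_le ha
    (Filter.Eventually.of_forall fun t ht => ?_) (hi _ (by fun_prop))
  have ht2 : t ^ 2 ≤ a ^ 2 := pow_le_pow_left₀ ht.1.le ht.2 2
  exact abs_exp_neg_sub_taylor_le (by positivity)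
    ((mul_le_mul_of_nonneg_left ht2 hc).trans h)

theorem gaussQ_eq_integral_exp (x : ℝ) :
    gaussQ x = 1 / 2 - 1 / √(2 * π) * ∫ t in (0 : ℝ)..x, Real.exp (-(1 / 2 * t ^ 2)) := by
  rw [gaussQ_eq, ← intervalIntegral.integral_const_mul]
  congr 2 with t
  simp only [stdGaussianPDF]
  ring_nf

theorem gaussQ_sqrt_two_mul (x : ℝ) :
    gaussQ (√2 * x) = 1 / 2 - 1 / √π * ∫ t in (0 : ℝ)..x, Real.exp (-(1 * t ^ 2)) := by
  have h2 : √2 ≠ 0 := by positivity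
  have hp : √π ≠ 0 := by positivity
  have hsq : √2 ^ 2 = 2 := Real.sq_sqrt (by norm_num)
  have h := intervalIntegral.mul_integral_comp_mul_left (a := 0) (b := x)
    (f := fun t => Real.exp (-(1 / 2 * t ^ 2))) (√2)
  have he : ∀ t : ℝ, Real.exp (-(1 / 2 * (√2 * t) ^ 2)) = Real.exp (-(1 * t ^ 2)) := by
    intro t
    rw [mul_pow, hsq]
    ring_nf
  simp_rw [he, mul_zero] at h
  rw [gaussQ_eq_integral_exp, ← h, Real.sqrt_mul (by norm_num)]
  field_simp

theorem one_div_sqrt_two_mul_pi_lt : 1 / √(2 * π) < 0.3989423 := by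
  have h : (2.5066282 : ℝ) < √(2 * π) := by
    apply Real.lt_sqrt_of_sq_lt
    linarith [Real.pi_gt_d20]
  rw [div_lt_iff₀ (by positivity)]
  linarith

theorem one_div_sqrt_pi_gt : 0.5641895 < 1 / √π := by
  have h : √π < (1.772454 : ℝ) := by
    rw [Real.sqrt_lt' (by norm_num)]
    linarith [Real.pi_lt_d6]
  rw [lt_div_iff₀ (by positivity)]
  linarith

theorem integral_exp_neg_half_mul_sq_lt :
    ∫ t in (0 : ℝ)..0.85308, Real.exp (-(1 / 2 * t ^ 2)) < 0.7599912 := by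
  have h := (abs_le.1 (abs_integral_exp_neg_mul_sq_sub_le (c := 1 / 2) (a := 0.85308)
    (by norm_num) (by norm_num) (by norm_num))).2
  norm_num [gaussTaylorIntegral] at h ⊢
  linarith

theorem integral_exp_neg_mul_sq_gt :
    0.684478 < ∫ t in (0 : ℝ)..0.85308, Real.exp (-(1 * t ^ 2)) := by
  have h := (abs_le.1 (abs_integral_exp_neg_mul_sq_sub_le (c := 1) (a := 0.85308)
    (by norm_num) (by norm_num) (by norm_num))).1
  norm_num [gaussTaylorIntegral] at h ⊢
  linarith

theorem exp_neg_lt : Real.exp (-(0.85308 ^ 2 / 2)) < 0.69498 := by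
  have h := (abs_le.1 (abs_exp_neg_sub_taylor_le (u := 0.85308 ^ 2 / 2)
    (by norm_num) (by norm_num))).2
  norm_num at h ⊢
  linarith

theorem gaussQ_gt : 0.1968 < gaussQ 0.85308 := by
  rw [gaussQ_eq_integral_exp]
  have h := mul_le_mul one_div_sqrt_two_mul_pi_lt.le integral_exp_neg_half_mul_sq_lt.le
    (intervalIntegral.integral_nonneg (by norm_num) fun t _ => (Real.exp_pos _).le) (by norm_num)
  linarith

theorem symmetricCoefficient_pos : 0 < symmetricCoefficient 0.85308 := by
  have hr := one_div_sqrt_pi_gt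
  have hc := one_div_sqrt_two_mul_pi_lt
  have hc0 : 0 < 1 / √(2 * π) := by positivity
  have hI := integral_exp_neg_half_mul_sq_lt
  have hI0 : 0 ≤ ∫ t in (0 : ℝ)..0.85308, Real.exp (-(1 / 2 * t ^ 2)) :=
    intervalIntegral.integral_nonneg (by norm_num) fun t _ => (Real.exp_pos _).le
  have hJ := integral_exp_neg_mul_sq_gt
  have hφ : stdGaussianPDF 0.85308 ≤ 0.3989423 * 0.69498 := by
    have := mul_le_mul hc.le exp_neg_lt.le (Real.exp_pos _).le (by norm_num)
    refine le_trans (le_of_eq ?_) this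
    simp only [stdGaussianPDF]
    ring_nf
  rw [symmetricCoefficient, gaussQ_sqrt_two_mul, gaussQ_eq_integral_exp]
  have h1 := mul_le_mul hc.le hI.le hI0 (by norm_num)
  have h2 := mul_le_mul hr.le hJ.le (by norm_num) (by positivity)
  have h3 := mul_le_mul hr.le (add_le_add_right h2 (1 / 2)) (by norm_num) (by positivity)
  have h4 := mul_le_mul (add_le_add_right h1 (3 / 2)) hφ (stdGaussianPDF_pos _).le (by norm_num)
  linarith

/-- **Positivity of the symmetric second-order coefficient.**
Let `g(ε) = (1/√π)·(1 − Q(√2·Q⁻¹(ε))) + (ε − 2)·φ(Q⁻¹(ε))`.  Then `g(ε) > 0` for all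
`ε ∈ (0, 0.1968]`.  (Here `y` plays the role of `Q⁻¹(ε)`, i.e. `Q(y) = ε`.)  This is the
claim that, when `C₁ = C₂` and `V₁ = V₂`, the square-root term in the converse expansion
of `log M*_sf(l, ε)` is strictly negative for all `ε ≤ 0.1968`. -/
theorem symmetric_second_order_coefficient_pos (ε y : ℝ)
    (hε : ε ∈ Set.Ioc (0 : ℝ) 0.1968) (hy : gaussQ y = ε) :
    0 < (1 / Real.sqrt Real.pi) * (1 - gaussQ (Real.sqrt 2 * y)) + (ε - 2) * stdGaussianPDF y := by
  have hlt : 0.85308 ≤ y := by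
    by_contra! hlt
    linarith [gaussQ_antitone hlt.le, gaussQ_gt, hε.2]
  have h := symmetricCoefficient_monotoneOn (by norm_num) (Set.mem_Ici.2 (by linarith)) hlt
  rw [← hy]
  exact symmetricCoefficient_pos.trans_le h
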